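/- arXiv:math/0309165 — 7 statements merged into one kernel-verified Lean document; each statement's English description precedes it below -/
import Mathlib

section
/- If a set R of finitary relations on a nonempty set A is Galois closed (R = sInv Aut R), then R is a ∩-closed Krasner algebra, i.e. R = ⟨R⟩_{KA,∩}. Consequently, for every set Q of finitary relations on A, ⟨Q⟩_{KA,∩} ⊆ sInv Aut Q. -/
open FirstOrder

/-- A finitary relation on `A` of arity `m+1` (so all arities are ≥ 1). -/
def Rels (A : Type*) : Type _ := Σ m : ℕ, Set (Fin (m + 1) → A)

/-- The image `g[ρ]` of a relation under a permutation. -/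
def permImage {A : Type*} (g : Equiv.Perm A) {m : ℕ} (ρ : Set (Fin m → A)) :
    Set (Fin m → A) := (fun a => ⇑g ∘ a) '' ρ

/-- `Aut R`: permutations strongly preserving every relation in `R`. -/
def AutR {A : Type*} (R : Set (Rels A)) : Set (Equiv.Perm A) :=
  {g | ∀ ρ ∈ R, permImage g ρ.2 = ρ.2}

/-- `sInv G`: relations strongly invariant under every permutation in `G`. -/
def sInvG {A : Type*} (G : Set (Equiv.Perm A)) : Set (Rels A) :=
  {ρ | ∀ g ∈ G, permImage g ρ.2 = ρ.2}

/-- The language with relation symbols `P i` of arity `k i`, for `i : Fin n`. -/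
def relLang (n : ℕ) (k : Fin n → ℕ) : Language where
  Functions := fun _ => Empty
  Relations := fun m => {i : Fin n // k i = m}

/-- The structure on `A` interpreting `P i` as `ρ i`. -/
def relStruct {A : Type*} {n : ℕ} {k : Fin n → ℕ}
    (ρ : ∀ i : Fin n, Set (Fin (k i) → A)) : (relLang n k).Structure A where
  funMap := fun f _ => f.elim
  RelMap := fun {m} r x => (fun j => x (Fin.cast r.2 j)) ∈ ρ r.1

/-- The logical operation given by a first-order formula `φ` with `m` free
variables, applied to the relations `ρ i`. -/
def logicalOp {A : Type*} {n : ℕ} {k : Fin n → ℕ}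
    (ρ : ∀ i : Fin n, Set (Fin (k i) → A)) {m : ℕ}
    (φ : (relLang n k).Formula (Fin m)) : Set (Fin m → A) :=
  letI := relStruct ρ
  {a | φ.Realize a}

/-- `R` is closed under all logical operations (i.e. `R` is a Krasner algebra). -/
def KrasnerClosed {A : Type*} (R : Set (Rels A)) : Prop :=
  ∀ (n : ℕ) (k : Fin n → ℕ) (ρ : ∀ i : Fin n, Set (Fin (k i + 1) → A)),
    (∀ i, (⟨k i, ρ i⟩ : Rels A) ∈ R) →
    ∀ (m : ℕ) (φ : (relLang n (fun i => k i + 1)).Formula (Fin (m + 1))),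
      (⟨m, logicalOp ρ φ⟩ : Rels A) ∈ R

/-- `R` is ∩-closed: it contains each `A^m` and is closed under arbitrary
intersections of relations of equal arity. -/
def InterClosed {A : Type*} (R : Set (Rels A)) : Prop :=
  (∀ m : ℕ, (⟨m, Set.univ⟩ : Rels A) ∈ R) ∧
  ∀ (m : ℕ) (Q : Set (Set (Fin (m + 1) → A))),
    (∀ ρ ∈ Q, (⟨m, ρ⟩ : Rels A) ∈ R) → (⟨m, ⋂₀ Q⟩ : Rels A) ∈ R

/-- `⟨Q⟩_{KA,∩}`: the least ∩-closed Krasner algebra containing `Q`. -/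
def KAInterClosure {A : Type*} (Q : Set (Rels A)) : Set (Rels A) :=
  ⋂₀ {R | Q ⊆ R ∧ KrasnerClosed R ∧ InterClosed R}

theorem permImage_eq_iff {A : Type*} (g : Equiv.Perm A) {m : ℕ} (ρ : Set (Fin m → A)) :
    permImage g ρ = ρ ↔ ∀ a, ⇑g ∘ a ∈ ρ ↔ a ∈ ρ := by
  have key : ∀ a, ⇑g ∘ a ∈ permImage g ρ ↔ a ∈ ρ := by
    intro a
    constructor
    · rintro ⟨b, hb, hab⟩
      have : b = a := by
        funext j
        exact g.injective (congrFun hab j)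
      exact this ▸ hb
    · intro ha
      exact ⟨a, ha, rfl⟩
  constructor
  · intro h a
    have := key a
    rwa [h] at this
  · intro h
    ext b
    have hb : ⇑g ∘ (⇑g.symm ∘ b) = b := by
      funext j
      simp
    have h1 := key (⇑g.symm ∘ b)
    have h2 := h (⇑g.symm ∘ b)
    rw [hb] at h1 h2
    exact h1.trans h2.symm

theorem sInvG_krasner {A : Type*} (G : Set (Equiv.Perm A)) : KrasnerClosed (sInvG G) := by
  intro n k ρ hρ m φ g hg
  refine (permImage_eq_iff g _).2 ?_
  intro a
  letI := relStruct ρ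
  let e : A ≃[relLang n (fun i => k i + 1)] A :=
    { toEquiv := g
      map_fun' := fun f _ => f.elim
      map_rel' := fun r x =>
        (permImage_eq_iff g (ρ r.1)).1 (hρ r.1 g hg) (fun j => x (Fin.cast r.2 j)) }
  exact FirstOrder.Language.StrongHomClass.realize_formula e φ (v := a)

theorem sInvG_inter {A : Type*} (G : Set (Equiv.Perm A)) : InterClosed (sInvG G) := by
  constructor
  · intro m g _
    exact (permImage_eq_iff g _).2 fun a => by simp
  · intro m Q hQ g hg
    refine (permImage_eq_iff g _).2 fun a => ?_
    simp only [Set.mem_sInter]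
    exact forall₂_congr fun ρ h => (permImage_eq_iff g ρ).1 (hQ ρ h g hg) a

theorem closure_sub {A : Type*} (Q : Set (Rels A)) : KAInterClosure Q ⊆ sInvG (AutR Q) :=
  Set.sInter_subset_of_mem
    ⟨fun ρ hρ _ hg => hg ρ hρ, sInvG_krasner _, sInvG_inter _⟩

/-- If a set `R` of finitary relations on a nonempty set `A` is
Galois closed (`R = sInv Aut R`), then `R` is a ∩-closed Krasner algebra,
i.e. `R = ⟨R⟩_{KA,∩}`.  Consequently, for every set `Q` of finitary relations
on `A`, `⟨Q⟩_{KA,∩} ⊆ sInv Aut Q`. -/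
theorem stmt0 {A : Type*} [Nonempty A] :
    (∀ R : Set (Rels A), R = sInvG (AutR R) → R = KAInterClosure R) ∧
    (∀ Q : Set (Rels A), KAInterClosure Q ⊆ sInvG (AutR Q)) := by
  refine ⟨fun R hR => ?_, closure_sub⟩
  refine Set.Subset.antisymm (Set.subset_sInter fun S hS => hS.1) ?_
  exact (closure_sub R).trans hR.symm.subset
end

section
/- Let R be a set of finitary relations on a nonempty set A that is ∩-closed and closed under complementation. Then R = sInv Aut R if and only if for all m ≥ 1 and all a, b ∈ A^m with a ~_R b there exists an automorphism g ∈ Aut R with b = g(a). -/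
open FirstOrder

/-- `Γ_R(a)`: the intersection of all relations in `R` of the arity of `a`
containing `a`. -/
def Gamma {A : Type*} (R : Set (Rels A)) {m : ℕ} (a : Fin (m + 1) → A) :
    Set (Fin (m + 1) → A) :=
  ⋂₀ {ρ | (⟨m, ρ⟩ : Rels A) ∈ R ∧ a ∈ ρ}

/-- `R` is closed under complementation. -/
def CompClosed {A : Type*} (R : Set (Rels A)) : Prop :=
  ∀ (m : ℕ) (ρ : Set (Fin (m + 1) → A)), (⟨m, ρ⟩ : Rels A) ∈ R → (⟨m, ρᶜ⟩ : Rels A) ∈ R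

/-- Let `R` be ∩-closed and closed under complementation.
Then `R = sInv Aut R` iff for all `m ≥ 1` and all `a, b ∈ A^m` with `a ~_R b`
there is an automorphism `g ∈ Aut R` with `b = g(a)`. -/
theorem stmt3 {A : Type*} [Nonempty A] (R : Set (Rels A))
    (hI : InterClosed R) (hC : CompClosed R) :
    R = sInvG (AutR R) ↔
      ∀ (m : ℕ) (a b : Fin (m + 1) → A), a ∈ Gamma R b →
        ∃ g ∈ AutR R, b = ⇑g ∘ a := by
  constructor
  · intro hR m a b hab
    have hinv : ∀ g ∈ AutR R, g⁻¹ ∈ AutR R := by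
      intro g hg ρ hρ
      have h := hg ρ hρ
      ext x
      constructor
      · rintro ⟨y, hy, rfl⟩
        rw [← h] at hy
        obtain ⟨z, hz, rfl⟩ := hy
        have e : (⇑g⁻¹ ∘ (⇑g ∘ z)) = z := by
          funext i
          simp
        change (⇑g⁻¹ ∘ (⇑g ∘ z)) ∈ ρ.2
        rw [e]
        exact hz
      · intro hx
        refine ⟨⇑g ∘ x, ?_, ?_⟩
        · rw [← h]
          exact ⟨x, hx, rfl⟩
        · funext i
          simp
    have hmul : ∀ g ∈ AutR R, ∀ h ∈ AutR R, g * h ∈ AutR R := by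
      intro g hg h hh ρ hρ
      have h1 := hg ρ hρ
      have h2 := hh ρ hρ
      have e : permImage (g * h) ρ.2 = permImage g (permImage h ρ.2) := by
        unfold permImage
        rw [Set.image_image]
        rfl
      rw [e, h2, h1]
    have hs : (⟨m, {x | ∃ g ∈ AutR R, b = ⇑g ∘ x}⟩ : Rels A) ∈ R := by
      refine hR.ge ?_
      intro h hh
      ext x
      constructor
      · rintro ⟨y, ⟨g, hg, hb⟩, rfl⟩
        refine ⟨g * h⁻¹, hmul g hg _ (hinv h hh), ?_⟩
        rw [hb]
        funext i
        simp
      · rintro ⟨g, hg, hb⟩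
        refine ⟨⇑h⁻¹ ∘ x, ⟨g * h, hmul g hg h hh, ?_⟩, ?_⟩
        · rw [hb]
          funext i
          simp
        · funext i
          simp
    refine hab _ ⟨hs, 1, ?_, ?_⟩
    · intro ρ _
      exact Set.image_id _
    · rfl
  · intro H
    apply Set.Subset.antisymm
    · intro ρ hρ g hg
      exact hg ρ hρ
    · rintro ⟨m, ρ⟩ hρ
      have e : ρ = ⋂₀ {σ | ∃ b, b ∉ ρ ∧ σ = (Gamma R b)ᶜ} := by
        ext x
        constructor
        · rintro hx _ ⟨b, hb, rfl⟩ hxb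
          obtain ⟨g, hg, rfl⟩ := H m x b hxb
          apply hb
          have h : permImage g ρ = ρ := hρ g hg
          rw [← h]
          exact ⟨x, hx, rfl⟩
        · intro hx
          by_contra hn
          exact hx _ ⟨x, hn, rfl⟩ (fun σ hσ => hσ.2)
      rw [e]
      apply hI.2
      rintro _ ⟨b, _, rfl⟩
      apply hC
      apply hI.2
      intro σ hσ
      exact hσ.1
end

section
/- A set G of permutations of a nonempty set A is Galois closed (G = Aut sInv G) if and only if G is a subgroup of Sym(A) (G = ⟨G⟩_group) and G is locally closed (Loc_o G = G). -/
open FirstOrder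

/-- `Loc_o G`: permutations that agree with some member of `G` on every finite
tuple. -/
def LocO {A : Type*} (G : Set (Equiv.Perm A)) : Set (Equiv.Perm A) :=
  {f | ∀ (m : ℕ) (a : Fin (m + 1) → A), ∃ g ∈ G, ⇑f ∘ a = ⇑g ∘ a}

/-- A set `G` of permutations of a nonempty set `A` is Galois
closed (`G = Aut sInv G`) iff `G` is a subgroup of `Sym(A)` (`G = ⟨G⟩_group`)
and `G` is locally closed (`Loc_o G = G`). -/
theorem stmt5 {A : Type*} [Nonempty A] (G : Set (Equiv.Perm A)) :
    G = AutR (sInvG G) ↔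
      (G = (Subgroup.closure G : Subgroup (Equiv.Perm A)) ∧ LocO G = G) := by
  constructor
  · intro hG
    have hmem : ∀ g, g ∈ G ↔ ∀ ρ ∈ sInvG G, permImage g ρ.2 = ρ.2 := fun g => by
      conv_lhs => rw [hG]
      rfl
    have hiff : ∀ (g : Equiv.Perm A) (m : ℕ) (ρ : Set (Fin m → A)),
        permImage g ρ = ρ ↔ ∀ a : Fin m → A, ⇑g ∘ a ∈ ρ ↔ a ∈ ρ := by
      intro g m ρ
      constructor
      · intro h a
        constructor
        · intro ha
          rw [← h] at ha
          obtain ⟨b, hb, hab⟩ := ha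
          have : b = a := g.injective.comp_left hab
          exact this ▸ hb
        · intro ha
          rw [← h]
          exact ⟨a, ha, rfl⟩
      · intro h
        ext b
        constructor
        · rintro ⟨a, ha, rfl⟩
          exact (h a).2 ha
        · intro hb
          have e : ⇑g ∘ (⇑g.symm ∘ b) = b := by
            funext i
            simp
          exact ⟨⇑g.symm ∘ b, (h _).1 (e.symm ▸ hb), e⟩
    refine ⟨?_, ?_⟩
    · refine Set.Subset.antisymm Subgroup.subset_closure ?_
      intro g hg
      induction hg using Subgroup.closure_induction with
      | mem x hx => exact hx
      | one =>
        rw [hmem]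
        intro ρ _
        rw [hiff]
        intro a
        exact Iff.rfl
      | mul x y _ _ hx hy =>
        rw [hmem] at hx hy ⊢
        intro ρ hρ
        have h1 := (hiff _ _ _).1 (hx ρ hρ)
        have h2 := (hiff _ _ _).1 (hy ρ hρ)
        rw [hiff]
        intro a
        exact (h1 (⇑y ∘ a)).trans (h2 a)
      | inv x _ hx =>
        rw [hmem] at hx ⊢
        intro ρ hρ
        have h1 := (hiff _ _ _).1 (hx ρ hρ)
        rw [hiff]
        intro a
        have e : ⇑x ∘ (⇑x⁻¹ ∘ a) = a := by
          funext i
          simp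
        rw [← h1, e]
    · apply Set.Subset.antisymm
      · intro f hf
        rw [hmem]
        rintro ⟨m, ρ⟩ hρ
        rw [hiff]
        intro a
        obtain ⟨g, hg, hfg⟩ := hf m a
        rw [hfg]
        exact (hiff _ _ _).1 (hρ g hg) a
      · intro f hf m a
        exact ⟨f, hf, rfl⟩
  · rintro ⟨hG, hL⟩
    apply Set.Subset.antisymm
    · intro g hg ρ hρ
      exact hρ g hg
    · intro f hf
      rw [← hL]
      intro m a
      have hmul : ∀ x ∈ G, ∀ y ∈ G, x * y ∈ G := by
        intro x hx y hy
        rw [hG] at hx hy ⊢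
        exact mul_mem hx hy
      have hinv : ∀ x ∈ G, x⁻¹ ∈ G := by
        intro x hx
        rw [hG] at hx ⊢
        exact inv_mem hx
      have hone : (1 : Equiv.Perm A) ∈ G := by
        rw [hG]
        exact one_mem _
      have hρ : (⟨m, {b | ∃ g ∈ G, b = ⇑g ∘ a}⟩ : Rels A) ∈ sInvG G := by
        intro g hg
        apply Set.Subset.antisymm
        · rintro _ ⟨b, ⟨k, hk, rfl⟩, rfl⟩
          exact ⟨g * k, hmul g hg k hk, rfl⟩
        · rintro _ ⟨k, hk, rfl⟩
          refine ⟨⇑(g⁻¹ * k) ∘ a, ⟨g⁻¹ * k, hmul _ (hinv g hg) k hk, rfl⟩, ?_⟩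
          funext i
          simp
      have h := hf _ hρ
      have h2 : ⇑f ∘ a ∈ permImage f {b | ∃ g ∈ G, b = ⇑g ∘ a} :=
        ⟨a, ⟨1, hone, rfl⟩, rfl⟩
      have h3 : ⇑f ∘ a ∈ {b | ∃ g ∈ G, b = ⇑g ∘ a} := h.subset h2
      exact h3
end

section
/- Let R be a set of finitary relations on a nonempty set A that is ∩-closed and closed under complementation. Then R = sInv Aut R if and only if R is closed under strong superposition. -/
open FirstOrder

universe u

/-- The strong superposition `sSup_{a,(b_i)}(ρ_i)` with parameters `a ∈ A^m`,
`b i ∈ A^{k i + 1}`. -/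
def strongSup {A : Type u} {I : Type u} {m : ℕ} (a : Fin (m + 1) → A) {k : I → ℕ}
    (b : ∀ i : I, Fin (k i + 1) → A) (ρ : ∀ i : I, Set (Fin (k i + 1) → A)) :
    Set (Fin (m + 1) → A) :=
  {c | ∃ g : Equiv.Perm A, c = ⇑g ∘ a ∧ ∀ i : I, ⇑g ∘ b i ∈ ρ i}

/-- `R` is closed under strong superposition. -/
def StrongSupClosed {A : Type u} (R : Set (Rels A)) : Prop :=
  ∀ (I : Type u) (m : ℕ) (a : Fin (m + 1) → A) (k : I → ℕ)
    (b : ∀ i : I, Fin (k i + 1) → A) (ρ : ∀ i : I, Set (Fin (k i + 1) → A)),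
    (∀ i, (⟨k i, ρ i⟩ : Rels A) ∈ R) → (⟨m, strongSup a b ρ⟩ : Rels A) ∈ R

theorem mem_AutR_iff {A : Type u} (R : Set (Rels A)) (g : Equiv.Perm A) :
    g ∈ AutR R ↔ ∀ (m : ℕ) (ρ : Set (Fin (m + 1) → A)), (⟨m, ρ⟩ : Rels A) ∈ R →
      ∀ a, ⇑g ∘ a ∈ ρ ↔ a ∈ ρ := by
  constructor
  · intro hg m ρ hρ a
    have h : permImage g ρ = ρ := hg ⟨m, ρ⟩ hρ
    constructor
    · intro ha
      rw [← h] at ha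
      obtain ⟨b, hb, hba⟩ := ha
      have : b = a := funext fun i => g.injective (congrFun hba i)
      exact this ▸ hb
    · intro ha
      rw [← h]
      exact ⟨a, ha, rfl⟩
  · rintro h ⟨m, ρ⟩ hρ
    apply Set.Subset.antisymm
    · rintro _ ⟨a, ha, rfl⟩
      exact (h m ρ hρ a).2 ha
    · intro a ha
      have e : ⇑g ∘ (⇑g.symm ∘ a) = a := by
        funext i; simp
      refine ⟨⇑g.symm ∘ a, ?_, e⟩
      apply (h m ρ hρ _).1
      rw [e]; exact ha

theorem AutR_symm {A : Type u} (R : Set (Rels A)) (g : Equiv.Perm A) (hg : g ∈ AutR R) :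
    g.symm ∈ AutR R := by
  rw [mem_AutR_iff] at hg ⊢
  intro m ρ hρ a
  have e : ⇑g ∘ (⇑g.symm ∘ a) = a := by
    funext i; simp
  rw [← hg m ρ hρ (⇑g.symm ∘ a), e]

/-- Let `R` be ∩-closed and closed under complementation.
Then `R = sInv Aut R` iff `R` is closed under strong superposition. -/
theorem stmt6 {A : Type u} [Nonempty A] (R : Set (Rels A))
    (hI : InterClosed R) (hC : CompClosed R) :
    R = sInvG (AutR R) ↔ StrongSupClosed R := by
  constructor
  · intro hR I m a k b ρ hρ
    have key : ∀ h ∈ AutR R, ∀ c ∈ strongSup a b ρ, ⇑h ∘ c ∈ strongSup a b ρ := by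
      rintro h hh _ ⟨g, rfl, hg⟩
      refine ⟨g.trans h, rfl, fun i => ?_⟩
      exact ((mem_AutR_iff R h).1 hh (k i) (ρ i) (hρ i) (⇑g ∘ b i)).2 (hg i)
    rw [hR]
    intro h hh
    apply Set.Subset.antisymm
    · rintro _ ⟨c, hc, rfl⟩
      exact key h hh c hc
    · intro c hc
      refine ⟨⇑h.symm ∘ c, key _ (AutR_symm R h hh) c hc, ?_⟩
      funext i; simp
  · intro hS
    apply Set.Subset.antisymm
    · intro ρ hρ g hg
      exact hg ρ hρ
    · rintro ⟨m, ρ⟩ hρ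
      have orb : ∀ a : Fin (m + 1) → A,
          (⟨m, {c | ∃ g ∈ AutR R, c = ⇑g ∘ a}⟩ : Rels A) ∈ R := by
        intro a
        have h := hS (Σ k : ℕ, (Fin (k + 1) → A)) m a (fun i => i.1) (fun i => i.2)
          (fun i => ⋂₀ {σ | (⟨i.1, σ⟩ : Rels A) ∈ R ∧ i.2 ∈ σ})
          (fun i => hI.2 _ _ fun σ hσ => hσ.1)
        convert h using 2
        ext c
        constructor
        · rintro ⟨g, hg, rfl⟩
          refine ⟨g, rfl, fun i σ hσ => ?_⟩
          exact ((mem_AutR_iff R g).1 hg _ σ hσ.1 _).2 hσ.2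
        · rintro ⟨g, rfl, hg⟩
          refine ⟨g, (mem_AutR_iff R g).2 ?_, rfl⟩
          intro n σ hσ b
          constructor
          · intro hb
            by_contra hn
            exact hg ⟨n, b⟩ σᶜ ⟨hC n σ hσ, hn⟩ hb
          · intro hb
            exact hg ⟨n, b⟩ σ ⟨hσ, hb⟩
      have h := hC m _ (hI.2 m {τ | ∃ a ∈ ρ, τ = {c | ∃ g ∈ AutR R, c = ⇑g ∘ a}ᶜ} (by
        rintro _ ⟨a, _, rfl⟩
        exact hC _ _ (orb a)))
      suffices e : ρ = (⋂₀ {τ | ∃ a ∈ ρ, τ = {c | ∃ g ∈ AutR R, c = ⇑g ∘ a}ᶜ})ᶜ by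
        exact (congrArg (fun τ => (⟨m, τ⟩ : Rels A) ∈ R) e).mpr h
      ext c
      constructor
      · intro hc hn
        refine hn _ ⟨c, hc, rfl⟩ ⟨Equiv.refl A, ?_, rfl⟩
        rw [mem_AutR_iff]
        intro n σ _ b
        exact Iff.rfl
      · intro hc
        by_contra hn
        apply hc
        rintro _ ⟨a, ha, rfl⟩ ⟨g, hg, rfl⟩
        apply hn
        have e : permImage g ρ = ρ := hρ g hg
        rw [← e]
        exact ⟨a, ha, rfl⟩
end

section
/- If Q is a finite set of finitary relations on a nonempty set A, then sInv Aut Q = ⟨Q⟩_inv, the closure of Q under all invariant operations. -/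
open FirstOrder

/-- An invariant (finitary) operation on relations. -/
def Invariant {A : Type*} {n : ℕ} {k : Fin n → ℕ} {m : ℕ}
    (F : (∀ i : Fin n, Set (Fin (k i + 1) → A)) → Set (Fin (m + 1) → A)) : Prop :=
  ∀ (g : Equiv.Perm A) (ρ : ∀ i : Fin n, Set (Fin (k i + 1) → A)),
    F (fun i => permImage g (ρ i)) = permImage g (F ρ)

/-- `R` is closed under all invariant (finitary) operations. -/
def InvClosed {A : Type*} (R : Set (Rels A)) : Prop :=
  ∀ (n : ℕ) (k : Fin n → ℕ) (m : ℕ)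
    (F : (∀ i : Fin n, Set (Fin (k i + 1) → A)) → Set (Fin (m + 1) → A)),
    Invariant F → ∀ ρ : ∀ i : Fin n, Set (Fin (k i + 1) → A),
      (∀ i, (⟨k i, ρ i⟩ : Rels A) ∈ R) → (⟨m, F ρ⟩ : Rels A) ∈ R

/-- `⟨Q⟩_inv`: the closure of `Q` under all invariant operations. -/
def invClosure {A : Type*} (Q : Set (Rels A)) : Set (Rels A) :=
  ⋂₀ {R | Q ⊆ R ∧ InvClosed R}

theorem permImage_mul {A : Type*} (g h : Equiv.Perm A) {m : ℕ} (ρ : Set (Fin m → A)) :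
    permImage g (permImage h ρ) = permImage (g * h) ρ := by
  unfold permImage
  rw [Set.image_image]
  rfl

theorem permImage_one {A : Type*} {m : ℕ} (ρ : Set (Fin m → A)) :
    permImage (1 : Equiv.Perm A) ρ = ρ := by
  unfold permImage
  exact Set.image_id ρ

/-- If `Q` is a finite set of finitary relations on a nonempty
set `A`, then `sInv Aut Q = ⟨Q⟩_inv`. -/
theorem stmt9 {A : Type*} [Nonempty A] (Q : Set (Rels A)) (hQ : Q.Finite) :
    sInvG (AutR Q) = invClosure Q := by
  apply Set.Subset.antisymm
  · rintro ⟨m, ρ⟩ hρ R ⟨hQR, hR⟩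
    obtain ⟨n, q, hq⟩ := (show ∃ n, ∃ q : Fin n → Rels A, Set.range q = Q from by
      obtain ⟨n, q, _, hq⟩ := hQ.fin_param
      exact ⟨n, q, hq⟩)
    subst hq
    let F : (∀ i : Fin n, Set (Fin ((q i).1 + 1) → A)) → Set (Fin (m + 1) → A) :=
      fun σ => {x | ∃ g : Equiv.Perm A, (∀ i, σ i = permImage g (q i).2) ∧ x ∈ permImage g ρ}
    have hle : ∀ (g : Equiv.Perm A) σ, permImage g (F σ) ⊆ F (fun i => permImage g (σ i)) := by
      rintro g σ _ ⟨x, ⟨h, h1, h2⟩, rfl⟩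
      refine ⟨g * h, fun i => ?_, ?_⟩
      · show permImage g (σ i) = _
        rw [h1 i, permImage_mul]
      · rw [← permImage_mul]
        exact ⟨x, h2, rfl⟩
    have hF : Invariant F := by
      intro g σ
      apply Set.Subset.antisymm _ (hle g σ)
      intro x hx
      have h3 := hle g⁻¹ (fun i => permImage g (σ i)) ⟨x, hx, rfl⟩
      simp only [permImage_mul, inv_mul_cancel, permImage_one] at h3
      refine ⟨_, h3, ?_⟩
      funext j
      simp
    have key : F (fun i => (q i).2) = ρ := by
      apply Set.Subset.antisymm
      · rintro x ⟨g, h1, h2⟩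
        have h3 : permImage g ρ = ρ := hρ g (by
          rintro _ ⟨i, rfl⟩
          exact (h1 i).symm)
        rwa [h3] at h2
      · intro x hx
        refine ⟨1, fun i => (permImage_one _).symm, ?_⟩
        rwa [permImage_one]
    have := hR n (fun i => (q i).1) m F hF (fun i => (q i).2) (fun i => hQR ⟨i, rfl⟩)
    rwa [key] at this
  · apply Set.sInter_subset_of_mem
    refine ⟨fun ρ hρ g hg => hg ρ hρ, ?_⟩
    intro n k m F hF ρ hρ g hg
    show permImage g (F ρ) = F ρ
    rw [← hF g ρ]
    congr 1
    funext i
    exact hρ i g hg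
end

section
/- The relation ⊏ between L-structures with universes contained in ω_1 is transitive: if 𝐌_1 ⊏ 𝐌_2 and 𝐌_2 ⊏ 𝐌_3, then 𝐌_1 ⊏ 𝐌_3. -/
open FirstOrder

/-- The set `ω₁` of countable ordinals, with its (well-ordered) linear order. -/
abbrev Omega1 : Type 1 := {x : Ordinal.{0} // x < (Cardinal.aleph 1).ord}

/-- An `L`-structure whose universe is a subset of `ω₁`, where `L` has one
relation symbol of each arity `m ≥ 1` (`rels m` is the interpretation of the
`(m+1)`-ary symbol; it only relates members of the universe). -/
structure SubStruct : Type 1 where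
  carrier : Set Omega1
  rels : ∀ m : ℕ, Set (Fin (m + 1) → Omega1)
  rels_mem : ∀ m a, a ∈ rels m → ∀ i, a i ∈ carrier

/-- `N` is a substructure of `M`. -/
def IsSub (N M : SubStruct) : Prop :=
  N.carrier ⊆ M.carrier ∧ ∀ (m : ℕ) (a : Fin (m + 1) → Omega1),
    (∀ i, a i ∈ N.carrier) → (a ∈ N.rels m ↔ a ∈ M.rels m)

/-- `N ⊏_h M`: `N` is a proper substructure of `M` and every tuple from `M`
that is weak for `h` (it meets `M ∖ N`, the domain of `h`, and all its
`h`-values are smaller than its length) satisfies a relation of `M` iff it is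
strictly increasing in the well-order of `ω₁`. -/
def SqLtH (N M : SubStruct) (h : Omega1 → ℕ) : Prop :=
  N.carrier ⊂ M.carrier ∧ IsSub N M ∧
  ∀ (n : ℕ) (a : Fin (n + 1) → Omega1), (∀ i, a i ∈ M.carrier) →
    (∃ i, a i ∈ M.carrier \ N.carrier) →
    (∀ i, a i ∈ M.carrier \ N.carrier → h (a i) < n + 1) →
    (a ∈ M.rels n ↔ StrictMono a)

/-- `N ⊏ M`: `N ⊏_h M` for some `h` defined on `M ∖ N`. -/
def SqLt (N M : SubStruct) : Prop := ∃ h : Omega1 → ℕ, SqLtH N M h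
/-- The relation `⊏` between structures with universes
contained in `ω₁` is transitive. -/
theorem stmt12 (M₁ M₂ M₃ : SubStruct) (h12 : SqLt M₁ M₂) (h23 : SqLt M₂ M₃) :
    SqLt M₁ M₃ := by
  classical
  obtain ⟨h, hs, ⟨hsub, hrel⟩, hw⟩ := h12
  obtain ⟨k, ks, ⟨ksub, krel⟩, kw⟩ := h23
  refine ⟨fun x => if x ∈ M₂.carrier then h x else k x, hs.trans ks,
    ⟨hsub.trans ksub, fun m a ha => (hrel m a ha).trans (krel m a fun i => hsub (ha i))⟩, ?_⟩
  intro n a ha hex hlt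
  by_cases hc : ∃ i, a i ∉ M₂.carrier
  · obtain ⟨i, hi⟩ := hc
    refine kw n a ha ⟨i, ha i, hi⟩ fun j hj => ?_
    have := hlt j ⟨hj.1, fun h' => hj.2 (hsub h')⟩
    simpa [hj.2] using this
  · push Not at hc
    rw [← krel n a hc]
    obtain ⟨i, hi⟩ := hex
    refine hw n a hc ⟨i, hc i, hi.2⟩ fun j hj => ?_
    have := hlt j ⟨ha j, hj.2⟩
    simpa [hj.1] using this
end

section
/- Let 𝐌_0 be a countable L-structure with universe M_0 ⊆ ω_1 satisfying, for every m, the axiom ρ_m(x_1,…,x_m) → ⋀_{1≤i<j≤m} x_i ≠ x_j. Let π_0 be a partial automorphism of the reduct 𝐌_0^{[s]} for some s ∈ ω, and let α ∈ ω_1. Then there exist a countable L-structure 𝐌_ω with M_0 ⊂ M_ω ⊂ ω_1 and α ∈ M_ω, and a total automorphism π_ω of the reduct 𝐌_ω^{[s]}, such that: (1) 𝐌_0 ⊏ 𝐌_ω; (2) 𝐌_ω is a model of the theory T; (3) π_ω extends π_0. -/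
open FirstOrder

/-- An atom in the variables `x_0, …, x_n`: a relation symbol of arity
`k+1 ≤ n+1` together with an assignment of variables to its places. -/
def Atom (n : ℕ) : Type := Σ k : Fin (n + 1), (Fin (k.1 + 1) → Fin (n + 1))

/-- A clause in `x_0, …, x_n` is a partial assignment of signs to atoms; it is
valid if every literal uses pairwise distinct variables among which is `x_0`. -/
def ValidClause {n : ℕ} (K : Atom n → Option Bool) : Prop :=
  ∀ a : Atom n, K a ≠ none → Function.Injective a.2 ∧ ∃ j, a.2 j = 0

/-- The tuple `v = (x_0, …, x_n)` satisfies the clause `K` in `M`. -/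
def SatClause (M : SubStruct) {n : ℕ} (K : Atom n → Option Bool)
    (v : Fin (n + 1) → Omega1) : Prop :=
  ∀ a : Atom n,
    (K a = some true → (fun j => v (a.2 j)) ∈ M.rels a.1.1) ∧
    (K a = some false → (fun j => v (a.2 j)) ∉ M.rels a.1.1)

/-- `M` is a model of the theory `T`: (T1) every related tuple has pairwise
distinct entries, and (T2) for every valid clause `K` in `x_0, …, x_n` and all
pairwise distinct `x_1, …, x_n` in `M` there is `x_0` in `M` satisfying `K`. -/
def ModelsT (M : SubStruct) : Prop :=
  (∀ (m : ℕ) (a : Fin (m + 1) → Omega1), a ∈ M.rels m → Function.Injective a) ∧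
  ∀ (n : ℕ) (K : Atom n → Option Bool), ValidClause K →
    ∀ x : Fin n → Omega1, (∀ i, x i ∈ M.carrier) → Function.Injective x →
      ∃ x₀ ∈ M.carrier, SatClause M K (Fin.cons x₀ x)

/-- `p` restricted to `d` is a partial automorphism of the reduct `M^{[s]}`
(the reduct keeping only the relations of arity at most `s`). -/
def PartialAutoReduct (M : SubStruct) (s : ℕ) (d : Set Omega1) (p : Omega1 → Omega1) : Prop :=
  d ⊆ M.carrier ∧ Set.InjOn p d ∧ (∀ x ∈ d, p x ∈ M.carrier) ∧
  ∀ m : ℕ, m + 1 ≤ s → ∀ a : Fin (m + 1) → Omega1, (∀ i, a i ∈ d) →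
    (a ∈ M.rels m ↔ (fun i => p (a i)) ∈ M.rels m)

/-- `q` is a (total) automorphism of the reduct `M^{[s]}`. -/
def AutoReduct (M : SubStruct) (s : ℕ) (q : Omega1 → Omega1) : Prop :=
  PartialAutoReduct M s M.carrier q ∧ Set.BijOn q M.carrier M.carrier

namespace S13

def VV {n : ℕ} (w : Omega1) (x : Fin n → Omega1) : Fin (n + 1) → Omega1 := Fin.cons w x

abbrev Task : Type 1 := Σ n : ℕ, (Atom n → Option Bool) × (Fin n → Omega1)

/-- data of the ambient permutation -/
structure Setup (M : SubStruct) (d : Set Omega1) (p : Omega1 → Omega1) (α : Omega1) where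
  C : Set Omega1
  P : Equiv.Perm Omega1
  w : ℕ → Omega1
  r : Omega1 → ℕ
  hC : C.Countable
  hMC : M.carrier ⊆ C
  hα : α ∈ C
  hPC : ∀ x, P x ∈ C ↔ x ∈ C
  hPd : ∀ x ∈ d, P x = p x
  hQ : ∀ x ∈ M.carrier, ∀ k : ℕ, (P ^ (k + 1)) x ∈ M.carrier → x ∈ d
  hwC : ∀ i, w i ∈ C
  hrP : ∀ x, r (P x) = r x
  hrw : ∀ i, r (w i) = i + 1
  hrM : ∀ x ∈ M.carrier, r x = 0
  hfree : ∀ i (k : ℤ), (P ^ k) (w i) = w i → k = 0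

def Valid (r : Omega1 → ℕ) (i : ℕ) (τ : Task) : Prop :=
  ValidClause τ.2.1 ∧ Function.Injective τ.2.2 ∧ ∀ j, r (τ.2.2 j) ≤ i

def Pos (w : ℕ → Omega1) (r : Omega1 → ℕ) (t : ℕ → Task) (m : ℕ) (a : Fin (m + 1) → Omega1) :
    Prop :=
  ∃ i, Valid r i (t i) ∧ ∃ (hm : m < (t i).1 + 1) (f : Fin (m + 1) → Fin ((t i).1 + 1)),
    (t i).2.1 ⟨⟨m, hm⟩, f⟩ = some true ∧ a = fun j => VV (w i) (t i).2.2 (f j)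

def GG (M : SubStruct) (s : ℕ) (P : Equiv.Perm Omega1) (w : ℕ → Omega1) (r : Omega1 → ℕ)
    (t : ℕ → Task) (m : ℕ) (a : Fin (m + 1) → Omega1) : Prop :=
  ∃ k : ℤ, (k = 0 ∨ m + 1 ≤ s) ∧
    ((fun j => (P ^ k) (a j)) ∈ M.rels m ∨ Pos w r t m (fun j => (P ^ k) (a j)))

def Weak (M : SubStruct) (h : Omega1 → ℕ) (m : ℕ) (a : Fin (m + 1) → Omega1) : Prop :=
  (∃ i, a i ∉ M.carrier) ∧ ∀ i, a i ∉ M.carrier → h (a i) < m + 1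

theorem rpow {P : Equiv.Perm Omega1} {r : Omega1 → ℕ} (h : ∀ x, r (P x) = r x) (k : ℤ) (x) :
    r ((P ^ k) x) = r x := by
  induction k using Int.induction_on generalizing x with
  | zero => simp
  | succ n ih => rw [zpow_add_one, Equiv.Perm.mul_apply, ih, h]
  | pred n ih =>
    rw [zpow_sub_one, Equiv.Perm.mul_apply, ih, ← h (P⁻¹ x)]; simp

theorem rV_le {r : Omega1 → ℕ} {w : ℕ → Omega1} (hrw : ∀ i, r (w i) = i + 1) {i : ℕ} {τ : Task}
    (hv : Valid r i τ) (j) : r (VV (w i) τ.2.2 j) ≤ i + 1 := by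
  refine Fin.cases ?_ (fun j => ?_) j
  · simp [VV, hrw]
  · have := hv.2.2 j
    simp only [VV, Fin.cons_succ]; omega

theorem V_eq {r : Omega1 → ℕ} {w : ℕ → Omega1} {i : ℕ} {τ : Task}
    (hv : Valid r i τ) (j) (hj : r (VV (w i) τ.2.2 j) = i + 1) : VV (w i) τ.2.2 j = w i := by
  revert hj
  refine Fin.cases ?_ (fun j => ?_) j
  · simp [VV]
  · have := hv.2.2 j
    simp only [VV, Fin.cons_succ]; omega

theorem V_inj {r : Omega1 → ℕ} {w : ℕ → Omega1} (hrw : ∀ i, r (w i) = i + 1) {i : ℕ} {τ : Task}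
    (hv : Valid r i τ) : Function.Injective (VV (w i) τ.2.2) := by
  unfold VV
  rw [Fin.cons_injective_iff]
  refine ⟨?_, hv.2.1⟩
  rintro ⟨j, hj⟩
  have := hv.2.2 j
  rw [hj, hrw] at this
  omega

theorem pos_top {r : Omega1 → ℕ} {w : ℕ → Omega1} {i : ℕ} {τ : Task}
    (hv : Valid r i τ) {m : ℕ} (hm : m < τ.1 + 1) (f : Fin (m + 1) → Fin (τ.1 + 1)) {b : Bool}
    (h : τ.2.1 ⟨⟨m, hm⟩, f⟩ = some b) : Function.Injective f ∧ ∃ j, VV (w i) τ.2.2 (f j) = w i := by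
  obtain ⟨h1, j, hj⟩ := hv.1 ⟨⟨m, hm⟩, f⟩ (by rw [h]; simp)
  refine ⟨h1, j, ?_⟩
  have hj' : f j = 0 := hj
  rw [hj']; simp [VV]

theorem consist {M : SubStruct} {s : ℕ} {d : Set Omega1} {p : Omega1 → Omega1} {α : Omega1}
    (hp : PartialAutoReduct M s d p) (S : Setup M d p α) (m : ℕ) (hm : m + 1 ≤ s) (k : ℕ) :
    ∀ a : Fin (m + 1) → Omega1, (∀ i, a i ∈ M.carrier) → (∀ i, (S.P ^ k) (a i) ∈ M.carrier) →
    (a ∈ M.rels m ↔ (fun i => (S.P ^ k) (a i)) ∈ M.rels m) := by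
  induction k with
  | zero => intro a _ _; simp
  | succ k ih =>
    intro a ha hk
    have hd : ∀ i, a i ∈ d := fun i => S.hQ _ (ha i) k (hk i)
    rw [hp.2.2.2 m hm a hd]
    have e : (fun i => p (a i)) = fun i => S.P (a i) := by
      funext i; rw [S.hPd _ (hd i)]
    rw [e, ih (fun i => S.P (a i))]
    · simp only [pow_succ, Equiv.Perm.mul_apply]
    · intro i
      simp only [S.hPd _ (hd i)]
      exact hp.2.2.1 _ (hd i)
    · intro i
      have := hk i
      rwa [pow_succ, Equiv.Perm.mul_apply] at this

theorem consistZ {M : SubStruct} {s : ℕ} {d : Set Omega1} {p : Omega1 → Omega1} {α : Omega1}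
    (hp : PartialAutoReduct M s d p) (S : Setup M d p α) (m : ℕ) (hm : m + 1 ≤ s) (k : ℤ)
    (a : Fin (m + 1) → Omega1) (ha : ∀ i, a i ∈ M.carrier)
    (hk : ∀ i, (S.P ^ k) (a i) ∈ M.carrier) :
    (a ∈ M.rels m ↔ (fun i => (S.P ^ k) (a i)) ∈ M.rels m) := by
  obtain ⟨n, rfl | rfl⟩ := k.eq_nat_or_neg
  · exact consist hp S m hm n a ha (by simpa using hk)
  · have := consist hp S m hm n (fun i => (S.P ^ (-(n : ℤ))) (a i)) hk (by simpa using ha)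
    rw [this]; simp

theorem GG_M {M : SubStruct} {s : ℕ} {d : Set Omega1} {p : Omega1 → Omega1} {α : Omega1}
    (hp : PartialAutoReduct M s d p) (S : Setup M d p α) (t : ℕ → Task) (m : ℕ)
    (a : Fin (m + 1) → Omega1) (ha : ∀ i, a i ∈ M.carrier) :
    GG M s S.P S.w S.r t m a ↔ a ∈ M.rels m := by
  constructor
  · rintro ⟨k, hk, h | ⟨i, hv, hm, f, hK, he⟩⟩
    · rcases hk with rfl | hk
      · simpa using h
      · exact (consistZ hp S m hk k a ha (M.rels_mem m _ h)).2 h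
    · exfalso
      obtain ⟨-, j, hj⟩ := pos_top (w := S.w) hv hm f hK
      have h1 := congrFun he j
      simp only [hj] at h1
      have h2 := congrArg S.r h1
      rw [rpow S.hrP, S.hrw, S.hrM _ (ha j)] at h2
      omega
  · intro h
    exact ⟨0, Or.inl rfl, Or.inl (by simpa using h)⟩

theorem GG_P {M : SubStruct} {s : ℕ} {P : Equiv.Perm Omega1} {w : ℕ → Omega1} {r : Omega1 → ℕ}
    (t : ℕ → Task) (m : ℕ) (hm : m + 1 ≤ s) (a : Fin (m + 1) → Omega1) :
    GG M s P w r t m a ↔ GG M s P w r t m (fun i => P (a i)) := by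
  constructor
  · rintro ⟨k, -, h⟩
    refine ⟨k - 1, Or.inr hm, ?_⟩
    simpa [zpow_sub_one] using h
  · rintro ⟨k, -, h⟩
    refine ⟨k + 1, Or.inr hm, ?_⟩
    simpa [zpow_add_one] using h

theorem GG_inj {M : SubStruct} {s : ℕ} {d : Set Omega1} {p : Omega1 → Omega1} {α : Omega1}
    (hT1 : ∀ (m : ℕ) (a : Fin (m + 1) → Omega1), a ∈ M.rels m → Function.Injective a)
    (S : Setup M d p α) (t : ℕ → Task) (m : ℕ)
    (a : Fin (m + 1) → Omega1) (h : GG M s S.P S.w S.r t m a) : Function.Injective a := by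
  obtain ⟨k, hk, h | ⟨i, hv, hm, f, hK, he⟩⟩ := h
  · exact Function.Injective.of_comp (f := (S.P ^ k)) (hT1 m _ h)
  · apply Function.Injective.of_comp (f := (S.P ^ k))
    have : (S.P ^ k) ∘ a = VV (S.w i) (t i).2.2 ∘ f := he
    rw [this]
    exact (V_inj S.hrw hv).comp (pos_top (w := S.w) hv hm f hK).1

theorem GG_false {M : SubStruct} {s : ℕ} {d : Set Omega1} {p : Omega1 → Omega1} {α : Omega1}
    (S : Setup M d p α) (t : ℕ → Task) (m : ℕ) (i : ℕ) (hv : Valid S.r i (t i))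
    (hm : m < (t i).1 + 1) (f : Fin (m + 1) → Fin ((t i).1 + 1))
    (hK : (t i).2.1 ⟨⟨m, hm⟩, f⟩ = some false) :
    ¬ GG M s S.P S.w S.r t m (fun j => VV (S.w i) (t i).2.2 (f j)) := by
  obtain ⟨-, j, hj⟩ := pos_top (w := S.w) hv hm f hK
  rintro ⟨k, -, h | ⟨i', hv', hm', f', hK', he⟩⟩
  · have h1 := S.hrM _ (M.rels_mem m _ h j)
    simp only [rpow S.hrP, hj, S.hrw] at h1
    omega
  · obtain ⟨-, j', hj'⟩ := pos_top (w := S.w) hv' hm' f' hK'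
    have e1 := congrArg S.r (congrFun he j)
    have e2 := congrArg S.r (congrFun he j')
    simp only [rpow S.hrP, hj, hj', S.hrw] at e1 e2
    have b1 := rV_le S.hrw hv (f j')
    have b2 := rV_le S.hrw hv' (f' j)
    obtain rfl : i = i' := by omega
    have e3 := congrFun he j
    simp only at e3
    rw [V_eq hv' (f' j) e1.symm, hj] at e3
    obtain rfl := S.hfree i k e3
    have : f = f' := by
      funext l
      apply V_inj S.hrw hv
      simpa using congrFun he l
    subst this
    rw [hK] at hK'
    simp at hK'

instance (n : ℕ) : Finite (Atom n) := by unfold Atom; infer_instance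

theorem exists_tasks (C : Set Omega1) (hC : C.Countable) :
    ∃ t : ℕ → Task, (∀ i j, (t i).2.2 j ∈ C) ∧ ∀ τ : Task, (∀ j, τ.2.2 j ∈ C) →
      ∀ N, ∃ i, N ≤ i ∧ t i = τ := by
  have := hC.to_subtype
  let T := Σ n : ℕ, (Atom n → Option Bool) × (Fin n → C)
  have : Countable T := by
    have : ∀ n, Countable (Atom n → Option Bool) := fun n => inferInstance
    infer_instance
  have : Nonempty T := ⟨⟨0, fun _ => none, Fin.elim0⟩⟩
  obtain ⟨g, hg⟩ := exists_surjective_nat T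
  let c : T → Task := fun τ => ⟨τ.1, τ.2.1, fun j => (τ.2.2 j : Omega1)⟩
  refine ⟨fun i => c (g i.unpair.1), fun i j => (((g i.unpair.1).2.2 j).2), ?_⟩
  rintro ⟨n, K, x⟩ hx N
  obtain ⟨u, hu⟩ := hg ⟨n, K, fun j => ⟨x j, hx j⟩⟩
  refine ⟨Nat.pair u N, Nat.right_le_pair _ _, ?_⟩
  simp [hu, c]

theorem main_of_setup {M : SubStruct} {s : ℕ} {d : Set Omega1} {p : Omega1 → Omega1} {α : Omega1}
    (hT1 : ∀ (m : ℕ) (a : Fin (m + 1) → Omega1), a ∈ M.rels m → Function.Injective a)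
    (hp : PartialAutoReduct M s d p) (S : Setup M d p α) :
    ∃ (Mω : SubStruct) (q : Omega1 → Omega1), Mω.carrier = S.C ∧ 
      SqLt M Mω ∧ ModelsT Mω ∧
      AutoReduct Mω s q ∧ ∀ x ∈ d, q x = p x := by
  obtain ⟨t, htC, ht⟩ := exists_tasks S.C S.hC
  let h : Omega1 → ℕ := fun x => s + 1 + (t (S.r x - 1)).1
  have hwk : ∀ m a, Weak M h m a → ¬ (m + 1 ≤ s) := by
    rintro m a ⟨⟨i, hi⟩, h2⟩ h3
    have := h2 i hi
    simp only [h] at this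
    omega
  have hwM : ∀ i, S.w i ∉ M.carrier := fun i hi => by
    have := S.hrM _ hi
    rw [S.hrw] at this; omega
  let N : SubStruct :=
    { carrier := S.C
      rels := fun m => {a | (∀ i, a i ∈ S.C) ∧ ((Weak M h m a ∧ StrictMono a) ∨
        (¬ Weak M h m a ∧ GG M s S.P S.w S.r t m a))}
      rels_mem := fun m a ha => ha.1 }
  refine ⟨N, S.P, rfl, ⟨h, ?_, ?_, ?_⟩, ⟨?_, ?_⟩, ⟨⟨?_, ?_, ?_, ?_⟩, ?_⟩, S.hPd⟩
  · exact ⟨S.hMC, fun hh => hwM 0 (hh (S.hwC 0))⟩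
  · refine ⟨S.hMC, fun m a ha => ?_⟩
    have hnw : ¬ Weak M h m a := fun hw => by
      obtain ⟨⟨i, hi⟩, -⟩ := hw
      exact hi (ha i)
    rw [← GG_M hp S t m a ha]
    simp only [N, Set.mem_ofPred_eq, hnw]
    have : ∀ i, a i ∈ S.C := fun i => S.hMC (ha i)
    simp [this]
  · intro n a ha h1 h2
    have hw : Weak M h n a := by
      obtain ⟨i, hi⟩ := h1
      exact ⟨⟨i, hi.2⟩, fun i hi => h2 i ⟨ha i, hi⟩⟩
    have ha' : ∀ i, a i ∈ S.C := ha
    simp only [N, Set.mem_ofPred_eq, hw]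
    simp [ha']
  · rintro m a ⟨-, ⟨-, hs⟩ | ⟨-, hg⟩⟩
    · exact hs.injective
    · exact GG_inj hT1 S t m a hg
  · intro n K hK x hx hinj
    obtain ⟨i, hi, hti⟩ := ht ⟨n, K, x⟩ hx (∑ j, S.r (x j))
    refine ⟨S.w i, S.hwC i, ?_⟩
    have hv : Valid S.r i (t i) := by
      rw [hti]
      refine ⟨hK, hinj, fun j => le_trans ?_ hi⟩
      exact Finset.single_le_sum (f := fun j => S.r (x j)) (fun _ _ => Nat.zero_le _)
        (Finset.mem_univ j)
    have hV : ∀ j, VV (S.w i) (t i).2.2 j ∈ S.C := by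
      intro j
      refine Fin.cases ?_ (fun j => ?_) j
      · simpa [VV] using S.hwC i
      · simpa [VV] using htC i j
    have key : ∀ (a : Atom (t i).1), 
        ((t i).2.1 a = some true → (fun j => VV (S.w i) (t i).2.2 (a.2 j)) ∈ N.rels a.1.1) ∧
        ((t i).2.1 a = some false → (fun j => VV (S.w i) (t i).2.2 (a.2 j)) ∉ N.rels a.1.1) := by
      rintro ⟨⟨m, hm⟩, f⟩
      have nw : ∀ b, (t i).2.1 ⟨⟨m, hm⟩, f⟩ = some b →
          ¬ Weak M h m (fun j => VV (S.w i) (t i).2.2 (f j)) := by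
        rintro b hb ⟨-, h2⟩
        obtain ⟨-, j, hj⟩ := pos_top (w := S.w) hv hm f hb
        have h3 := h2 j
        simp only [hj] at h3
        have h4 := h3 (hwM i)
        simp only [h, S.hrw, Nat.add_sub_cancel] at h4
        omega
      constructor
      · intro hb
        refine ⟨fun j => hV _, Or.inr ⟨nw _ hb, 0, Or.inl rfl, Or.inr ⟨i, hv, hm, f, hb, ?_⟩⟩⟩
        simp
      · rintro hb ⟨-, ⟨hw, -⟩ | ⟨-, hg⟩⟩
        · exact nw _ hb hw
        · exact GG_false S t m i hv hm f hb hg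
    clear_value N
    clear ht hv hV
    generalize t i = τ at hti key
    subst hti
    exact key
  · exact fun _ hx => hx
  · exact S.P.injective.injOn
  · exact fun x hx => (S.hPC x).2 hx
  · intro m hm a ha
    have ha' : ∀ i, a i ∈ S.C := ha
    have n1 : ¬ Weak M h m a := fun hh => hwk _ _ hh hm
    have n2 : ¬ Weak M h m (fun i => S.P (a i)) := fun hh => hwk _ _ hh hm
    simp only [N, Set.mem_ofPred_eq, n1, n2, GG_P t m hm a, S.hPC]
    simp
  · refine ⟨fun x hx => (S.hPC x).2 hx, S.P.injective.injOn, fun y hy => ?_⟩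
    refine ⟨S.P.symm y, (S.hPC _).1 ?_, by simp⟩
    simpa using hy


abbrev Fw (M d : Set Omega1) : Type 1 := {x : Omega1 // x ∈ M ∧ x ∉ d}
abbrev Bw (M d : Set Omega1) (p : Omega1 → Omega1) : Type 1 := {x : Omega1 // x ∈ M ∧ x ∉ p '' d}
abbrev New (M d : Set Omega1) (p : Omega1 → Omega1) : Type 1 :=
  (Fw M d × ℕ) ⊕ (Bw M d p × ℕ) ⊕ (ℕ × ℤ)
abbrev YY (M d : Set Omega1) (p : Omega1 → Omega1) : Type 1 := M ⊕ New M d p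

open Classical in
noncomputable def ff {M d : Set Omega1} {p : Omega1 → Omega1} (hp : ∀ x ∈ d, p x ∈ M) :
    YY M d p → YY M d p
  | .inl x => if h : x.1 ∈ d then .inl ⟨p x.1, hp _ h⟩ else .inr (.inl (⟨x.1, x.2, h⟩, 0))
  | .inr (.inl (x, n)) => .inr (.inl (x, n + 1))
  | .inr (.inr (.inl (x, 0))) => .inl ⟨x.1, x.2.1⟩
  | .inr (.inr (.inl (x, n + 1))) => .inr (.inr (.inl (x, n)))
  | .inr (.inr (.inr (i, z))) => .inr (.inr (.inr (i, z + 1)))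

theorem ff_bij {M d : Set Omega1} {p : Omega1 → Omega1} (hp : ∀ x ∈ d, p x ∈ M)
    (hd : d ⊆ M) (hinj : Set.InjOn p d) : Function.Bijective (ff hp) := by
  constructor
  · rintro (⟨x, hx⟩ | ⟨⟨x, hx⟩, n⟩ | ⟨⟨x, hx⟩, _ | n⟩ | ⟨i, z⟩)
      (⟨y, hy⟩ | ⟨⟨y, hy⟩, n'⟩ | ⟨⟨y, hy⟩, _ | n'⟩ | ⟨i', z'⟩) h
    all_goals simp only [ff] at h
    all_goals try split_ifs at h
    all_goals try (simp at h; done)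
    all_goals try (simp at h ⊢; first | exact h | exact hinj ‹_› ‹_› h)
    · simp at h
      rename_i hxd
      exact absurd ⟨x, hxd, h⟩ hy.2
    · simp at h
      rename_i hxd
      exact absurd ⟨y, hxd, h.symm⟩ hx.2
  · rintro (⟨x, hx⟩ | ⟨⟨x, hx⟩, _ | n⟩ | ⟨⟨x, hx⟩, n⟩ | ⟨i, z⟩)
    · by_cases h : x ∈ p '' d
      · obtain ⟨y, hy, rfl⟩ := h
        exact ⟨.inl ⟨y, hd hy⟩, by simp [ff, hy]⟩
      · exact ⟨.inr (.inr (.inl (⟨x, hx, h⟩, 0))), by simp [ff]⟩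
    · exact ⟨.inl ⟨x, hx.1⟩, by simp [ff, hx.2]⟩
    · exact ⟨.inr (.inl (⟨x, hx⟩, n)), by simp [ff]⟩
    · exact ⟨.inr (.inr (.inl (⟨x, hx⟩, n + 1))), by simp [ff]⟩
    · exact ⟨.inr (.inr (.inr (i, z - 1))), by simp [ff]⟩

theorem omega1_unc (A : Set Omega1) (hA : A.Countable) : ¬ (Aᶜ).Countable := by
  intro h
  have h1 : (Set.univ : Set Omega1).Countable := by
    rw [← Set.union_compl_self A]; exact hA.union h
  have h2 : Countable (Set.Iio ((Cardinal.aleph 1).ord : Ordinal.{0})) := Set.countable_univ_iff.1 h1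
  have h3 := Cardinal.mk_le_aleph0_iff.2 h2
  rw [Cardinal.mk_Iio_ordinal, Cardinal.card_ord] at h3
  simp at h3

theorem exists_embed (M d : Set Omega1) (p : Omega1 → Omega1) (hM : M.Countable) (α : Omega1) :
    ∃ e : YY M d p ↪ Omega1, (∀ x, e (.inl x) = x.1) ∧ α ∈ Set.range e := by
  have hinf : (Mᶜ).Infinite := fun hf => omega1_unc M hM hf.countable
  let ι := hinf.natEmbedding
  let A : Set Omega1 := Set.range (fun n => (ι n : Omega1)) ∪ ({α} \ M)
  have hAM : ∀ x ∈ A, x ∉ M := by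
    rintro x (⟨n, rfl⟩ | hx)
    · exact (ι n).2
    · exact hx.2
  have hAc : A.Countable := (Set.countable_range _).union ((Set.countable_singleton α).mono Set.sdiff_subset)
  have hAi : A.Infinite := by
    apply Set.Infinite.mono Set.subset_union_left
    apply Set.infinite_range_of_injective
    intro a b hab
    exact ι.injective (Subtype.ext hab)
  have := hAc.to_subtype
  have := hAi.to_subtype
  have : Countable (Fw M d) := (hM.mono (fun x hx => hx.1) : {x | x ∈ M ∧ x ∉ d}.Countable).to_subtype
  have : Countable (Bw M d p) := (hM.mono (fun x hx => hx.1) : {x | x ∈ M ∧ x ∉ p '' d}.Countable).to_subtype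
  obtain ⟨E⟩ : Nonempty (New M d p ≃ A) := nonempty_equiv_of_countable
  refine ⟨⟨Sum.elim (fun x => x.1) (fun y => (E y).1), ?_⟩, fun x => rfl, ?_⟩
  · apply Function.Injective.sumElim Subtype.val_injective (Subtype.val_injective.comp E.injective)
    intro a b hab
    apply hAM _ (E b).2
    have hab' : a.1 = (E b).1 := hab
    rw [← hab']; exact a.2
  · by_cases h : α ∈ M
    · exact ⟨.inl ⟨α, h⟩, rfl⟩
    · have hα : α ∈ A := Or.inr ⟨rfl, h⟩
      exact ⟨.inr (E.symm ⟨α, hα⟩), by simp⟩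

theorem exists_setup {M : SubStruct} {s : ℕ} {d : Set Omega1} {p : Omega1 → Omega1}
    (hM : M.carrier.Countable)
    (hp : PartialAutoReduct M s d p) (α : Omega1) : Nonempty (Setup M d p α) := by
  obtain ⟨e, he, hα⟩ := exists_embed M.carrier d p hM α
  obtain ⟨hd, hinj, hpm, -⟩ := hp
  let F : Equiv.Perm (YY M.carrier d p) := Equiv.ofBijective (ff hpm) (ff_bij hpm hd hinj)
  have hF : ∀ y, F y = ff hpm y := fun y => rfl
  let P := F.viaEmbedding e
  have hP : ∀ y, P (e y) = e (ff hpm y) := fun y => Equiv.Perm.viaEmbedding_apply F e y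
  have hP' : ∀ x, x ∉ Set.range e → P x = x := fun x hx =>
    Equiv.Perm.viaEmbedding_apply_of_notMem F e x hx
  let rY : YY M.carrier d p → ℕ
    | .inr (.inr (.inr (i, _))) => i + 1
    | _ => 0
  have hrY : ∀ y, rY (ff hpm y) = rY y := by
    rintro (⟨x, hx⟩ | ⟨⟨x, hx⟩, n⟩ | ⟨⟨x, hx⟩, _ | n⟩ | ⟨i, z⟩)
    all_goals simp only [ff]
    all_goals try split_ifs
    all_goals rfl
  let r : Omega1 → ℕ := Function.extend e rY (fun _ => 0)
  have hr : ∀ y, r (e y) = rY y := fun y => e.injective.extend_apply _ _ _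
  have hz : ∀ (i : ℕ) (k : ℤ) (z : ℤ), (P ^ k) (e (.inr (.inr (.inr (i, z))))) =
      e (.inr (.inr (.inr (i, z + k)))) := by
    intro i k
    induction k using Int.induction_on with
    | zero => simp
    | succ n ih =>
      intro z
      rw [zpow_add_one, Equiv.Perm.mul_apply, hP]
      simp only [ff]
      rw [ih]; congr 5; ring
    | pred n ih =>
      intro z
      have := hP (.inr (.inr (.inr (i, z - 1))))
      simp only [ff, sub_add_cancel] at this
      rw [zpow_sub_one, Equiv.Perm.mul_apply, ← this, ← Equiv.Perm.mul_apply P⁻¹ P, inv_mul_cancel, Equiv.Perm.one_apply, ih]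
      congr 5; ring
  have hfw : ∀ (x : Fw M.carrier d) (k n : ℕ), (P ^ k) (e (.inr (.inl (x, n)))) =
      e (.inr (.inl (x, n + k))) := by
    intro x k
    induction k with
    | zero => simp
    | succ k ih =>
      intro n
      rw [pow_succ, Equiv.Perm.mul_apply, hP]
      simp only [ff]
      rw [ih]; congr 4; ring
  have hMe : ∀ x (hx : x ∈ M.carrier), x = e (.inl ⟨x, hx⟩) := fun x hx => (he ⟨x, hx⟩).symm
  refine ⟨⟨Set.range e, P, fun i => e (.inr (.inr (.inr (i, 0)))), r, ?_, ?_, hα, ?_, ?_, ?_, ?_, ?_, ?_, ?_, ?_⟩⟩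
  · have := hM.to_subtype
    have : Countable (Fw M.carrier d) :=
      (hM.mono (fun x hx => hx.1) : {x | x ∈ M.carrier ∧ x ∉ d}.Countable).to_subtype
    have : Countable (Bw M.carrier d p) :=
      (hM.mono (fun x hx => hx.1) : {x | x ∈ M.carrier ∧ x ∉ p '' d}.Countable).to_subtype
    exact Set.countable_range _
  · exact fun x hx => ⟨_, (hMe x hx).symm⟩
  · intro x
    constructor
    · intro h
      by_contra hx
      rw [hP' x hx] at h
      exact hx h
    · rintro ⟨y, rfl⟩
      exact ⟨_, (hP y).symm⟩
  · intro x hx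
    conv_lhs => rw [hMe x (hd hx)]
    rw [hP]
    simp only [ff, hx, dite_true]
    rw [he]
  · intro x hx k hk
    by_contra hxd
    conv at hk => rw [hMe x hx]
    rw [pow_succ, Equiv.Perm.mul_apply, hP] at hk
    simp only [ff, hxd, dite_false] at hk
    rw [hfw] at hk
    have := hMe _ hk
    simpa using e.injective this
  · exact fun i => ⟨_, rfl⟩
  · intro x
    by_cases hx : x ∈ Set.range e
    · obtain ⟨y, rfl⟩ := hx
      rw [hP, hr, hr, hrY]
    · rw [hP' x hx]
  · intro i
    rw [hr]
  · intro x hx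
    rw [hMe x hx, hr]
  · intro i k h
    rw [hz] at h
    simpa using e.injective h

end S13

/-- Let `M₀` be a countable structure with universe
`M₀ ⊆ ω₁` in which every related tuple has pairwise distinct entries, let
`π₀` be a partial automorphism of the reduct `M₀^{[s]}`, and let `α ∈ ω₁`.
Then there are a countable structure `M_ω` with `M₀ ⊂ M_ω ⊂ ω₁` and
`α ∈ M_ω`, and a total automorphism `π_ω` of `M_ω^{[s]}` extending `π₀`,
such that `M₀ ⊏ M_ω` and `M_ω` is a model of the theory `T`. -/
theorem stmt13 (M₀ : SubStruct) (hcnt : M₀.carrier.Countable)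
    (hT1 : ∀ (m : ℕ) (a : Fin (m + 1) → Omega1), a ∈ M₀.rels m → Function.Injective a)
    (s : ℕ) (d : Set Omega1) (π₀ : Omega1 → Omega1)
    (hπ₀ : PartialAutoReduct M₀ s d π₀) (α : Omega1) :
    ∃ (Mω : SubStruct) (πω : Omega1 → Omega1),
      Mω.carrier.Countable ∧ M₀.carrier ⊂ Mω.carrier ∧ Mω.carrier ⊂ Set.univ ∧
      α ∈ Mω.carrier ∧ SqLt M₀ Mω ∧ ModelsT Mω ∧
      AutoReduct Mω s πω ∧ ∀ x ∈ d, πω x = π₀ x := by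
  obtain ⟨S⟩ := S13.exists_setup hcnt hπ₀ α
  obtain ⟨N, q, hN, h1, h2, h3, h4⟩ := S13.main_of_setup hT1 hπ₀ S
  have hc : N.carrier.Countable := hN ▸ S.hC
  refine ⟨N, q, hc, ?_, ?_, hN ▸ S.hα, h1, h2, h3, h4⟩
  · obtain ⟨h, hh, -⟩ := h1
    exact hh
  · refine ⟨Set.subset_univ _, fun hu => S13.omega1_unc N.carrier hc ?_⟩
    have : N.carrier = Set.univ := Set.univ_subset_iff.1 hu
    rw [this, Set.compl_univ]
    exact Set.countable_empty
end
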